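/- Sign of the derivative of the phase function along vertical lines through the saddle points (part of Lemma 3.2): Fix an integer M ≥ 1 and φ0 ∈ (0, π/(M+1)); set w_+ = ζ(φ0) and w_− = conj(ζ(φ0)) (so Re w_+ = Re w_−). Then for every real a > 0, the function y ↦ Re F̂(Re w_+ + iy; a) satisfies: its derivative is strictly negative for y > Im w_+, strictly positive for 0 < y < Im w_+, strictly negative for Im w_− < y < 0, and strictly positive for y < Im w_−. In particular, on each of the half-lines y > 0 and y < 0, this function attains its strict maximum at y = Im w_+ and y = Im w_−, respectively. -/

import Mathlib

open Complex Real Set Filter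

/-- The phase function `F̂(z; a)` (principal branch of `log`). -/
noncomputable def Fhat (M : ℕ) (z : ℂ) (a : ℝ) : ℂ :=
  ((M : ℂ) + 1) * z * (Complex.log z - 1) - (z - 1) * (Complex.log (z - 1) - 1) -
    z * (Real.log a : ℂ)

/-- The parametrization `ζ(φ)` of the steepest ascent curve. -/
noncomputable def zeta (M : ℕ) (φ : ℝ) : ℂ :=
  ((Real.sin ((M + 1) * φ) / Real.sin (M * φ) : ℝ) : ℂ) * Complex.exp ((φ : ℂ) * Complex.I)

/-- The parametrization `v(φ)` of the spectral variable. -/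
noncomputable def v (M : ℕ) (φ : ℝ) : ℝ :=
  Real.sin ((M + 1) * φ) ^ (M + 1) / (Real.sin φ * Real.sin (M * φ) ^ M)

/-- The real logarithm is irrelevant to the vertical derivative of `Re F̂`, which only sees the
arguments of `z` and `z - 1`. -/
lemma hasDerivAt_re_Fhat_vertical (M : ℕ) (a x y : ℝ) (hy : y ≠ 0) :
    HasDerivAt (fun t : ℝ => (Fhat M ((x : ℂ) + (t : ℂ) * Complex.I) a).re)
      (Complex.arg ((x : ℂ) + (y : ℂ) * Complex.I - 1) -
        (M + 1) * Complex.arg ((x : ℂ) + (y : ℂ) * Complex.I)) y := by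
  set z : ℂ := (x : ℂ) + (y : ℂ) * Complex.I with hz
  have hz1 : z ∈ Complex.slitPlane := Or.inr (by simpa [hz] using hy)
  have hz2 : z - 1 ∈ Complex.slitPlane := Or.inr (by simpa [hz] using hy)
  have hF : HasDerivAt (fun w : ℂ => Fhat M w a)
      ((M + 1) * Complex.log z - Complex.log (z - 1) - (Real.log a : ℂ)) z := by
    have h1 := (((hasDerivAt_id z).const_mul ((M : ℂ) + 1)).mul
      (((hasDerivAt_id z).clog hz1).sub_const 1))
    have h2 : HasDerivAt (fun w : ℂ => w - 1) 1 z := (hasDerivAt_id z).sub_const 1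
    have h3 := h2.mul ((h2.clog hz2).sub_const 1)
    have h4 := (h1.sub h3).sub ((hasDerivAt_id z).mul_const (Real.log a : ℂ))
    refine h4.congr_deriv ?_
    have e1 : z ≠ 0 := Complex.slitPlane_ne_zero hz1
    have e2 : z - 1 ≠ 0 := Complex.slitPlane_ne_zero hz2
    simp only [id]
    field_simp
    ring
  have hl : HasDerivAt (fun t : ℂ => (x : ℂ) + t * Complex.I) Complex.I (y : ℂ) := by
    simpa using ((hasDerivAt_id (y : ℂ)).mul_const Complex.I).const_add (x : ℂ)
  refine (HasDerivAt.comp (y : ℂ) hF hl).real_of_complex.congr_deriv ?_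
  have h5 : ((M : ℂ) + 1) = ((M + 1 : ℝ) : ℂ) := by push_cast; rfl
  rw [Complex.mul_I_re, h5, Complex.sub_im, Complex.sub_im, Complex.im_ofReal_mul,
    Complex.log_im, Complex.log_im, Complex.ofReal_im]
  ring

/-- `Re F̂` is symmetric under complex conjugation. -/
lemma re_Fhat_vertical_neg (M : ℕ) (a x y : ℝ) :
    (Fhat M ((x : ℂ) + ((-y : ℝ) : ℂ) * Complex.I) a).re =
      (Fhat M ((x : ℂ) + (y : ℂ) * Complex.I) a).re := by
  rcases eq_or_ne y 0 with rfl | hy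
  · simp
  set z : ℂ := (x : ℂ) + (y : ℂ) * Complex.I with hz
  have hc : (x : ℂ) + ((-y : ℝ) : ℂ) * Complex.I = (starRingEnd ℂ) z := by
    simp [hz]
  have h1 : z.arg ≠ Real.pi := fun h => by
    have := (Complex.arg_eq_pi_iff.1 h).2
    simp [hz, hy] at this
  have h2 : (z - 1).arg ≠ Real.pi := fun h => by
    have := (Complex.arg_eq_pi_iff.1 h).2
    simp [hz, hy] at this
  have hF : Fhat M ((starRingEnd ℂ) z) a = (starRingEnd ℂ) (Fhat M z a) := by
    have e : (starRingEnd ℂ) z - 1 = (starRingEnd ℂ) (z - 1) := by simp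
    simp only [Fhat]
    rw [e, Complex.log_conj _ h1, Complex.log_conj _ h2]
    simp only [map_sub, map_mul, map_add, map_one, Complex.conj_ofReal, map_natCast]
  rw [hc, hF, Complex.conj_re]

lemma abs_sin_nat_mul_le (n : ℕ) {α : ℝ} (h : 0 ≤ Real.sin α) :
    |Real.sin (n * α)| ≤ n * Real.sin α := by
  induction n with
  | zero => simp
  | succ n ih =>
    push_cast
    rw [add_mul, one_mul, Real.sin_add]
    calc _ ≤ |Real.sin (n * α)| * |Real.cos α| + |Real.cos (n * α)| * |Real.sin α| := by
          rw [← abs_mul, ← abs_mul]; exact abs_add_le _ _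
      _ ≤ |Real.sin (n * α)| * 1 + 1 * |Real.sin α| := by
          gcongr <;> exact Real.abs_cos_le_one _
      _ ≤ _ := by rw [abs_of_nonneg h]; linarith

lemma sin_succ_mul_lt {n : ℕ} (hn : 1 ≤ n) {α : ℝ} (h : 0 < Real.sin α) :
    Real.sin ((n + 1) * α) < (n + 1) * Real.sin α := by
  have h1 := abs_sin_nat_mul_le n h.le
  have hn' : (1 : ℝ) ≤ n := by exact_mod_cast hn
  have hc : |Real.cos α| < 1 := by
    rw [← sq_lt_one_iff_abs_lt_one]
    nlinarith [Real.sin_sq_add_cos_sq α]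
  rw [add_mul, one_mul, Real.sin_add]
  have h2 : Real.sin (n * α) * Real.cos α ≤ n * Real.sin α * |Real.cos α| := by
    calc _ ≤ |Real.sin (n * α) * Real.cos α| := le_abs_self _
      _ = |Real.sin (n * α)| * |Real.cos α| := abs_mul _ _
      _ ≤ _ := by gcongr
  have h3 : Real.cos (n * α) * Real.sin α ≤ Real.sin α :=
    mul_le_of_le_one_left h.le (Real.cos_le_one _)
  have h4 : 0 < (n : ℝ) * Real.sin α := by positivity
  nlinarith

lemma nat_mul_mem_Ioo_of_mem_Ioo {M : ℕ} (hM : 1 ≤ M) {θ : ℝ}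
    (hθ : θ ∈ Set.Ioo (0 : ℝ) (Real.pi / ((M : ℝ) + 1))) :
    (M : ℝ) * θ ∈ Set.Ioo (0 : ℝ) Real.pi ∧ ((M : ℝ) + 1) * θ ∈ Set.Ioo (0 : ℝ) Real.pi ∧
      θ ∈ Set.Ioo (0 : ℝ) (Real.pi / 2) := by
  obtain ⟨h0, h1⟩ := hθ
  have hM' : (1 : ℝ) ≤ M := by exact_mod_cast hM
  rw [lt_div_iff₀ (by positivity)] at h1
  refine ⟨⟨by positivity, by nlinarith⟩, ⟨by positivity, by linarith⟩, h0, by nlinarith⟩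

/-- The real part of `ζ` is strictly decreasing along its curve. -/
lemma strictAntiOn_re_zeta {M : ℕ} (hM : 1 ≤ M) :
    StrictAntiOn (fun θ : ℝ => Real.sin ((M + 1) * θ) * Real.cos θ / Real.sin (M * θ))
      (Set.Ioo (0 : ℝ) (Real.pi / ((M : ℝ) + 1))) := by
  have hd : ∀ θ ∈ Set.Ioo (0 : ℝ) (Real.pi / ((M : ℝ) + 1)),
      HasDerivAt (fun θ : ℝ => Real.sin ((M + 1) * θ) * Real.cos θ / Real.sin (M * θ))
        ((Real.sin ((M + 1) * (2 * θ)) - (M + 1) * Real.sin (2 * θ)) /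
          (2 * Real.sin (M * θ) ^ 2)) θ := by
    intro θ hθ
    obtain ⟨h1, -, -⟩ := nat_mul_mem_Ioo_of_mem_Ioo hM hθ
    have hs : Real.sin (M * θ) ≠ 0 := (Real.sin_pos_of_mem_Ioo h1).ne'
    have e1 := ((hasDerivAt_id θ).const_mul ((M : ℝ) + 1)).sin.mul (Real.hasDerivAt_cos θ)
    have e2 := e1.div ((hasDerivAt_id θ).const_mul (M : ℝ)).sin hs
    refine e2.congr_deriv ?_
    simp only [id, mul_one, Pi.mul_apply]
    have t1 : ((M : ℝ) + 1) * (2 * θ) = 2 * (M * θ + θ) := by ring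
    have t2 : ((M : ℝ) + 1) * θ = M * θ + θ := by ring
    rw [t1, t2, Real.sin_two_mul, Real.sin_two_mul, Real.sin_add, Real.cos_add]
    field_simp
    have p1 := Real.sin_sq_add_cos_sq (M * θ)
    linear_combination (-(M + 1) * Real.sin θ * Real.cos θ) * p1
  refine strictAntiOn_of_deriv_neg (convex_Ioo _ _)
    (fun θ hθ => (hd θ hθ).continuousAt.continuousWithinAt) fun θ hθ => ?_
  rw [interior_Ioo] at hθ
  obtain ⟨h1, -, h3⟩ := nat_mul_mem_Ioo_of_mem_Ioo hM hθ
  rw [(hd θ hθ).deriv]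
  have hs := Real.sin_pos_of_mem_Ioo h1
  have h2 : 0 < Real.sin (2 * θ) :=
    Real.sin_pos_of_pos_of_lt_pi (by linarith [h3.1]) (by linarith [h3.2])
  exact div_neg_of_neg_of_pos (by linarith [sin_succ_mul_lt hM h2]) (by positivity)

lemma re_zeta (M : ℕ) (φ : ℝ) :
    (zeta M φ).re = Real.sin ((M + 1) * φ) * Real.cos φ / Real.sin (M * φ) := by
  rw [zeta, Complex.re_ofReal_mul, Complex.exp_ofReal_mul_I_re]
  ring

lemma im_zeta (M : ℕ) (φ : ℝ) :
    (zeta M φ).im = Real.sin ((M + 1) * φ) * Real.sin φ / Real.sin (M * φ) := by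
  rw [zeta, Complex.im_ofReal_mul, Complex.exp_ofReal_mul_I_im]
  ring

/-- With `θ = arg z`, the quantity `sin (arg (z - 1) - (M + 1) θ)` is, up to a positive factor,
the imaginary part of `(z - 1) e ^ (-i (M + 1) θ)`. -/
lemma norm_mul_sin_arg_sub (M : ℕ) (z : ℂ) :
    ‖z - 1‖ * Real.sin (Complex.arg (z - 1) - (M + 1) * Complex.arg z) * Real.cos z.arg =
      Real.sin ((M + 1) * z.arg) * Real.cos z.arg - z.re * Real.sin (M * z.arg) := by
  have h1 := Complex.norm_mul_cos_arg (z - 1)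
  have h2 := Complex.norm_mul_sin_arg (z - 1)
  have h3 := Complex.norm_mul_cos_arg z
  have h4 := Complex.norm_mul_sin_arg z
  rw [Complex.sub_re, Complex.one_re] at h1
  rw [Complex.sub_im, Complex.one_im, sub_zero] at h2
  have h5 : Real.sin (M * z.arg) = Real.sin ((M + 1) * z.arg) * Real.cos z.arg -
      Real.cos ((M + 1) * z.arg) * Real.sin z.arg := by
    rw [← Real.sin_sub]; congr 1; ring
  rw [Real.sin_sub, h5]
  have h6 : z.re * Real.sin z.arg = z.im * Real.cos z.arg := by rw [← h3, ← h4]; ring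
  linear_combination Real.cos z.arg * (Real.cos ((M + 1) * z.arg) * h2 -
    Real.sin ((M + 1) * z.arg) * h1) - Real.cos ((M + 1) * z.arg) * h6

lemma arg_add_mul_I_mem {x y : ℝ} (hx : 0 < x) (hy : 0 < y) :
    Complex.arg ((x : ℂ) + (y : ℂ) * Complex.I) ∈ Set.Ioo 0 (Real.pi / 2) := by
  have hre : ((x : ℂ) + (y : ℂ) * Complex.I).re = x := by simp
  have him : ((x : ℂ) + (y : ℂ) * Complex.I).im = y := by simp
  refine ⟨lt_of_le_of_ne (Complex.arg_nonneg_iff.2 (by rw [him]; exact hy.le)) fun h => ?_,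
    (abs_lt.1 (Complex.abs_arg_lt_pi_div_two_iff.2 (Or.inl (by rw [hre]; exact hx)))).2⟩
  exact hy.ne' (him ▸ (Complex.arg_eq_zero_iff.1 h.symm).2)

lemma arg_sub_mul_arg_sign {M : ℕ} (hM : 1 ≤ M) {φ : ℝ}
    (hφ : φ ∈ Set.Ioo (0 : ℝ) (Real.pi / ((M : ℝ) + 1))) {y : ℝ} (hy : 0 < y) :
    (y < (zeta M φ).im → 0 < Complex.arg (((zeta M φ).re : ℂ) + (y : ℂ) * Complex.I - 1) -
        (M + 1) * Complex.arg (((zeta M φ).re : ℂ) + (y : ℂ) * Complex.I)) ∧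
    ((zeta M φ).im < y → Complex.arg (((zeta M φ).re : ℂ) + (y : ℂ) * Complex.I - 1) -
        (M + 1) * Complex.arg (((zeta M φ).re : ℂ) + (y : ℂ) * Complex.I) < 0) := by
  obtain ⟨h1, h2, h3⟩ := nat_mul_mem_Ioo_of_mem_Ioo hM hφ
  have s1 := Real.sin_pos_of_mem_Ioo h1
  have s2 := Real.sin_pos_of_mem_Ioo h2
  have hcφ : 0 < Real.cos φ := Real.cos_pos_of_mem_Ioo ⟨by linarith [h3.1, Real.pi_pos], h3.2⟩
  have hx : 0 < (zeta M φ).re := by rw [re_zeta]; positivity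
  have him : (zeta M φ).im = (zeta M φ).re * Real.tan φ := by
    rw [re_zeta, im_zeta, Real.tan_eq_sin_div_cos]; field_simp
  set x := (zeta M φ).re with hxdef
  set z : ℂ := (x : ℂ) + (y : ℂ) * Complex.I with hz
  have zre : z.re = x := by simp [hz]
  have zim : z.im = y := by simp [hz]
  obtain ⟨hθ0, hθ1⟩ := arg_add_mul_I_mem hx hy
  rw [← hz] at hθ0 hθ1
  have hc : 0 < Real.cos z.arg := Real.cos_pos_of_mem_Ioo ⟨by linarith, hθ1⟩
  have hyt : y = x * Real.tan z.arg := by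
    rw [Complex.tan_arg, zre, zim]; field_simp
  have hM0 : (0 : ℝ) < (M : ℝ) + 1 := by positivity
  have hβ0 : 0 < (z - 1).arg := by
    have : 0 ≤ (z - 1).arg := Complex.arg_nonneg_iff.2 (by simp [zim, hy.le])
    refine lt_of_le_of_ne this fun h => ?_
    have := (Complex.arg_eq_zero_iff.1 h.symm).2
    simp [zim] at this
    linarith
  have hβ1 : (z - 1).arg < Real.pi := by
    refine lt_of_le_of_ne (Complex.arg_le_pi _) fun h => ?_
    have := (Complex.arg_eq_pi_iff.1 h).2
    simp [zim] at this
    linarith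
  have hn : 0 < ‖z - 1‖ := norm_pos_iff.2 fun h => by simp [h] at hβ0
  have key := norm_mul_sin_arg_sub M z
  rw [zre] at key
  have hmem {θ : ℝ} (h : θ ∈ Set.Ioo 0 (Real.pi / 2)) :
      θ ∈ Set.Ioo (-(Real.pi / 2)) (Real.pi / 2) := ⟨by linarith [h.1, h.2], h.2⟩
  have htan : Real.tan z.arg < Real.tan φ ↔ z.arg < φ :=
    Real.strictMonoOn_tan.lt_iff_lt (hmem ⟨hθ0, hθ1⟩) (hmem h3)
  have htan' : Real.tan φ < Real.tan z.arg ↔ φ < z.arg :=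
    Real.strictMonoOn_tan.lt_iff_lt (hmem h3) (hmem ⟨hθ0, hθ1⟩)
  rw [him]
  constructor
  · intro hlt
    rw [hyt, mul_lt_mul_iff_right₀ hx, htan] at hlt
    have hθ : z.arg ∈ Set.Ioo (0 : ℝ) (Real.pi / ((M : ℝ) + 1)) := ⟨hθ0, hlt.trans hφ.2⟩
    obtain ⟨k1, k2, -⟩ := nat_mul_mem_Ioo_of_mem_Ioo hM hθ
    have hR := strictAntiOn_re_zeta hM hθ hφ hlt
    simp only [← re_zeta M φ, ← hxdef] at hR
    rw [lt_div_iff₀ (Real.sin_pos_of_mem_Ioo k1)] at hR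
    by_contra! hle
    have := Real.sin_nonpos_of_nonpos_of_neg_pi_le hle (by linarith [k2.2])
    have : ‖z - 1‖ * Real.sin ((z - 1).arg - (M + 1) * z.arg) * Real.cos z.arg ≤ 0 :=
      mul_nonpos_of_nonpos_of_nonneg (mul_nonpos_of_nonneg_of_nonpos hn.le this) hc.le
    linarith
  · intro hlt
    rw [hyt, mul_lt_mul_iff_right₀ hx, htan'] at hlt
    by_contra! hle
    have hθ : z.arg ∈ Set.Ioo (0 : ℝ) (Real.pi / ((M : ℝ) + 1)) :=
      ⟨hθ0, by rw [lt_div_iff₀ hM0]; linarith⟩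
    obtain ⟨k1, k2, -⟩ := nat_mul_mem_Ioo_of_mem_Ioo hM hθ
    have hR := strictAntiOn_re_zeta hM hφ hθ hlt
    simp only [← re_zeta M φ, ← hxdef] at hR
    rw [div_lt_iff₀ (Real.sin_pos_of_mem_Ioo k1)] at hR
    have := Real.sin_nonneg_of_nonneg_of_le_pi hle (by linarith [k2.1])
    have : 0 ≤ ‖z - 1‖ * Real.sin ((z - 1).arg - (M + 1) * z.arg) * Real.cos z.arg := by
      positivity
    linarith

/-- Sign of the derivative of the phase function along vertical lines through the saddle
points, and the resulting strict maxima (part of Lemma 3.2). -/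
theorem derivative_sign_on_vertical_line
    (M : ℕ) (hM : 1 ≤ M)
    (φ0 : ℝ) (hφ0 : φ0 ∈ Set.Ioo (0 : ℝ) (Real.pi / ((M : ℝ) + 1)))
    (a : ℝ) (ha : 0 < a) :
    (∀ y : ℝ, (zeta M φ0).im < y →
      deriv (fun t : ℝ => (Fhat M (((zeta M φ0).re : ℂ) + (t : ℂ) * Complex.I) a).re) y < 0) ∧
    (∀ y : ℝ, 0 < y → y < (zeta M φ0).im →
      0 < deriv (fun t : ℝ => (Fhat M (((zeta M φ0).re : ℂ) + (t : ℂ) * Complex.I) a).re) y) ∧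
    (∀ y : ℝ, ((starRingEnd ℂ) (zeta M φ0)).im < y → y < 0 →
      deriv (fun t : ℝ => (Fhat M (((zeta M φ0).re : ℂ) + (t : ℂ) * Complex.I) a).re) y < 0) ∧
    (∀ y : ℝ, y < ((starRingEnd ℂ) (zeta M φ0)).im →
      0 < deriv (fun t : ℝ => (Fhat M (((zeta M φ0).re : ℂ) + (t : ℂ) * Complex.I) a).re) y) ∧
    (∀ y : ℝ, 0 < y → y ≠ (zeta M φ0).im →
      (Fhat M (((zeta M φ0).re : ℂ) + (y : ℂ) * Complex.I) a).re <
        (Fhat M (((zeta M φ0).re : ℂ) + ((zeta M φ0).im : ℂ) * Complex.I) a).re) ∧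
    (∀ y : ℝ, y < 0 → y ≠ ((starRingEnd ℂ) (zeta M φ0)).im →
      (Fhat M (((zeta M φ0).re : ℂ) + (y : ℂ) * Complex.I) a).re <
        (Fhat M (((zeta M φ0).re : ℂ) + (((starRingEnd ℂ) (zeta M φ0)).im : ℂ) * Complex.I)
          a).re) := by
  set x := (zeta M φ0).re with hx
  set y₀ := (zeta M φ0).im with hy₀
  set f : ℝ → ℝ := fun t : ℝ => (Fhat M ((x : ℂ) + (t : ℂ) * Complex.I) a).re with hf
  have hy₀pos : 0 < y₀ := by
    obtain ⟨h1, h2, h3⟩ := nat_mul_mem_Ioo_of_mem_Ioo hM hφ0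
    have s1 := Real.sin_pos_of_mem_Ioo h1
    have s2 := Real.sin_pos_of_mem_Ioo h2
    have s3 : 0 < Real.sin φ0 := Real.sin_pos_of_pos_of_lt_pi h3.1 (by linarith [h3.1, h3.2])
    rw [hy₀, im_zeta]
    positivity
  have hd (y : ℝ) (hy : 0 < y) := hasDerivAt_re_Fhat_vertical M a x y hy.ne'
  have hcont : ContinuousOn f (Set.Ioi 0) := fun y hy =>
    (hd y hy).continuousAt.continuousWithinAt
  have hneg (y : ℝ) (h : y₀ < y) : deriv f y < 0 := by
    have hy := hy₀pos.trans h
    rw [(hd y hy).deriv]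
    exact (arg_sub_mul_arg_sign hM hφ0 hy).2 h
  have hpos (y : ℝ) (hy : 0 < y) (h : y < y₀) : 0 < deriv f y := by
    rw [(hd y hy).deriv]
    exact (arg_sub_mul_arg_sign hM hφ0 hy).1 h
  have heven (y : ℝ) : f (-y) = f y := re_Fhat_vertical_neg M a x y
  have hdneg (y : ℝ) : deriv f y = -deriv f (-y) := by
    rw [← deriv_comp_neg, funext heven]
  have hmax (y : ℝ) (hy : 0 < y) (hne : y ≠ y₀) : f y < f y₀ := by
    rcases lt_or_gt_of_ne hne with h | h
    · refine strictMonoOn_of_deriv_pos (convex_Ioc 0 y₀)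
        (hcont.mono Set.Ioc_subset_Ioi_self) (fun t ht => ?_) ⟨hy, h.le⟩ ⟨hy₀pos, le_rfl⟩ h
      rw [interior_Ioc] at ht
      exact hpos t ht.1 ht.2
    · refine strictAntiOn_of_deriv_neg (convex_Ici y₀)
        (hcont.mono fun t ht => hy₀pos.trans_le ht) (fun t ht => ?_) Set.self_mem_Ici h.le h
      rw [interior_Ici] at ht
      exact hneg t ht
  rw [Complex.conj_im, ← hy₀]
  refine ⟨hneg, hpos, fun y h1 h2 => ?_, fun y h => ?_, hmax, fun y hy hne => ?_⟩
  · rw [hdneg]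
    exact neg_neg_of_pos (hpos (-y) (by linarith) (by linarith))
  · rw [hdneg]
    exact neg_pos_of_neg (hneg (-y) (by linarith))
  · have := hmax (-y) (by linarith) (fun h => hne (by linarith))
    rw [heven, ← heven y₀] at this
    exact this
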